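/- arXiv:2206.08770 — 2 statements merged into one kernel-verified Lean document; each statement's English description precedes it below -/
import Mathlib

section
/- Let n ≥ 7, let W be a four-linear form on ℝⁿ with the symmetries of a Weyl tensor, and let h_{ij}(x) = (1/3)∑_{p,q=1}^n W_{ipjq} x_p x_q. Then for every t > 0: ∫_{ℝⁿ} ∑_{i,j,l=1}^n (∂_i h_{jl}(x))² · B_{t,0}(x)² dx = (4n(n−1)(n−2)/(9(n−4)(n−6))) · (∑_{k=1}^n T_{kk}) · t⁴ · ∫_{ℝⁿ} (1 + |x|²/(n(n−2)))^{−n} dx. -/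
open MeasureTheory Real

noncomputable section

/-- The Euclidean space `ℝⁿ`. -/
abbrev En (n : ℕ) := EuclideanSpace ℝ (Fin n)

/-- Partial derivative in the `i`-th coordinate direction. -/
noncomputable def pd {n : ℕ} (i : Fin n) (f : En n → ℝ) (x : En n) : ℝ :=
  fderiv ℝ f x (EuclideanSpace.single i 1)

/-- The standard bubble `B_{t,z}(x) = t^{(n-2)/2} (t² + |x-z|²/(n(n-2)))^{-(n-2)/2}`. -/
noncomputable def Bub (n : ℕ) (t : ℝ) (z x : En n) : ℝ :=
  t ^ (((n : ℝ) - 2) / 2) *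
    (t ^ 2 + ‖x - z‖ ^ 2 / ((n : ℝ) * ((n : ℝ) - 2))) ^ (-(((n : ℝ) - 2) / 2))

/-- `W` has the symmetries of a Weyl tensor. -/
def IsWeyl (n : ℕ) (W : Fin n → Fin n → Fin n → Fin n → ℝ) : Prop :=
  (∀ i j k l, W i j k l = -W j i k l) ∧
  (∀ i j k l, W i j k l = -W i j l k) ∧
  (∀ i j k l, W i j k l = W k l i j) ∧
  (∀ j l, ∑ i, W i j i l = 0) ∧
  (∀ i j k l, W i j k l + W j k i l + W k i j l = 0)

/-- `T_{kl} = ∑_{p,q,r} (W_{kpqr}+W_{krqp})(W_{lpqr}+W_{lrqp})`. -/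
def Tkl (n : ℕ) (W : Fin n → Fin n → Fin n → Fin n → ℝ) (k l : Fin n) : ℝ :=
  ∑ p, ∑ q, ∑ r, (W k p q r + W k r q p) * (W l p q r + W l r q p)

/-- The quadratic field associated to `W`: `h_{ij}(x) = (1/3)∑_{p,q} W_{ipjq} x_p x_q`. -/
noncomputable def hW (n : ℕ) (W : Fin n → Fin n → Fin n → Fin n → ℝ)
    (x : En n) (i j : Fin n) : ℝ :=
  (1 / 3) * ∑ p, ∑ q, W i p j q * x p * x q

/-- The radial profile `r ↦ r² / (1 + r²)^(n-2)` in dimension `n = m + 7` is integrable. -/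
lemma integrable_normSq_div_one_add_normSq_pow (m : ℕ) :
    Integrable (fun x : En (m + 7) => ‖x‖ ^ 2 / (1 + ‖x‖ ^ 2) ^ (m + 5)) := by
  have h := integrable_rpow_neg_one_add_norm_sq (E := En (m + 7)) (μ := volume)
    (r := ((2 * (m + 4) : ℕ) : ℝ)) (by
      rw [finrank_euclideanSpace_fin]
      exact_mod_cast (by omega : m + 7 < 2 * (m + 4)))
  refine h.mono' (Measurable.aestronglyMeasurable (by fun_prop)) (ae_of_all _ fun x => ?_)
  have h1 : (0 : ℝ) < 1 + ‖x‖ ^ 2 := by positivity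
  rw [Real.norm_of_nonneg (by positivity),
    show -((2 * (m + 4) : ℕ) : ℝ) / 2 = -((m + 4 : ℕ) : ℝ) by push_cast; ring,
    Real.rpow_neg h1.le, Real.rpow_natCast, div_le_iff₀ (by positivity), pow_succ (n := m + 4),
    inv_mul_cancel_left₀ (by positivity)]
  linarith

lemma integrable_one_div_one_add_normSq_pow (m : ℕ) :
    Integrable (fun x : En (m + 7) => 1 / (1 + ‖x‖ ^ 2) ^ (m + 7)) := by
  have h := integrable_rpow_neg_one_add_norm_sq (E := En (m + 7)) (μ := volume)
    (r := ((2 * (m + 7) : ℕ) : ℝ)) (by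
      rw [finrank_euclideanSpace_fin]
      exact_mod_cast (by omega : m + 7 < 2 * (m + 7)))
  refine h.congr (ae_of_all _ fun x => ?_)
  have h1 : (0 : ℝ) < 1 + ‖x‖ ^ 2 := by positivity
  simp only
  rw [show -((2 * (m + 7) : ℕ) : ℝ) / 2 = -((m + 7 : ℕ) : ℝ) by push_cast; ring,
    Real.rpow_neg h1.le, Real.rpow_natCast, one_div]

/-- For suitable `a`, `b`, `d`, the function `rⁿ (1 + r²)^(1-n) (a + b r² + d r⁴)` is a primitive of
`r^(n-1) (r² (1 + r²)^(2-n) + n a (1 + r²)^(-n))`, where `n = m + 7`. -/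
lemma hasDerivAt_radial_primitive (m : ℕ) {a b d : ℝ} (h3 : -((m : ℝ) + 1) * d = 1)
    (h2 : (m + 11) * d - (m + 3) * b = 2) (h1 : (m + 9) * b - (m + 5) * a = 1) (r : ℝ) :
    HasDerivAt (fun r : ℝ => r ^ (m + 7) / (1 + r ^ 2) ^ (m + 6) * (a + b * r ^ 2 + d * r ^ 4))
      (r ^ (m + 6) * (r ^ 2 / (1 + r ^ 2) ^ (m + 5)) +
        (m + 7) * a * (r ^ (m + 6) * (1 / (1 + r ^ 2) ^ (m + 7)))) r := by
  have hq : (0 : ℝ) < 1 + r ^ 2 := by positivity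
  have hP : HasDerivAt (fun r : ℝ => a + b * r ^ 2 + d * r ^ 4)
      (b * (2 * r) + d * (4 * r ^ 3)) r := by
    have := (((hasDerivAt_pow 2 r).const_mul b).const_add a).fun_add ((hasDerivAt_pow 4 r).const_mul d)
    simpa using this
  have hD : HasDerivAt (fun r : ℝ => (1 + r ^ 2) ^ (m + 6))
      ((m + 6 : ℕ) * (1 + r ^ 2) ^ (m + 5) * (2 * r)) r := by
    have := (((hasDerivAt_pow 2 r).const_add 1).fun_pow (m + 6))
    simpa using this
  have hN := hasDerivAt_pow (m + 7) r
  refine ((hN.fun_div hD (by positivity)).fun_mul hP).congr_deriv ?_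
  have hE : ((m + 7 : ℝ) - (m + 5) * r ^ 2) * (a + b * r ^ 2 + d * r ^ 4) +
      r * (1 + r ^ 2) * (b * (2 * r) + d * (4 * r ^ 3)) =
        r ^ 2 * (1 + r ^ 2) ^ 2 + (m + 7) * a := by
    linear_combination r ^ 6 * h3 + r ^ 4 * h2 + r ^ 2 * h1
  trans r ^ (m + 6) / (1 + r ^ 2) ^ (m + 7) * (r ^ 2 * (1 + r ^ 2) ^ 2 + (m + 7) * a)
  · rw [← hE, show m + 7 - 1 = m + 6 by omega]
    simp only [pow_succ (1 + r ^ 2) (m + 6), pow_succ (1 + r ^ 2) (m + 5), pow_succ r (m + 6)]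
    field_simp
    push_cast
    ring
  · simp only [pow_succ (1 + r ^ 2) (m + 6), pow_succ (1 + r ^ 2) (m + 5)]
    field_simp

lemma tendsto_radial_primitive (m : ℕ) (a b d : ℝ) :
    Filter.Tendsto
      (fun r : ℝ => r ^ (m + 7) / (1 + r ^ 2) ^ (m + 6) * (a + b * r ^ 2 + d * r ^ 4))
      Filter.atTop (nhds 0) := by
  have h0 : Filter.Tendsto (fun r : ℝ => (|a| + |b| + |d|) * r⁻¹) Filter.atTop (nhds 0) := by
    simpa using tendsto_inv_atTop_zero.const_mul (|a| + |b| + |d|)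
  refine squeeze_zero_norm' ?_ h0
  filter_upwards [Filter.eventually_ge_atTop 1] with r hr
  have hr0 : 0 < r := by linarith
  have hq : (0 : ℝ) < 1 + r ^ 2 := by positivity
  have hP : |a + b * r ^ 2 + d * r ^ 4| ≤ (|a| + |b| + |d|) * (1 + r ^ 2) ^ 2 := by
    have ha := abs_add_le (a + b * r ^ 2) (d * r ^ 4)
    have hb := abs_add_le a (b * r ^ 2)
    rw [abs_mul, abs_of_nonneg (by positivity : 0 ≤ r ^ 4)] at ha
    rw [abs_mul, abs_of_nonneg (by positivity : 0 ≤ r ^ 2)] at hb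
    have e1 : 0 ≤ |a| * (2 * r ^ 2 + r ^ 4) := by positivity
    have e2 : 0 ≤ |b| * (1 + r ^ 2 + r ^ 4) := by positivity
    have e3 : 0 ≤ |d| * (1 + 2 * r ^ 2) := by positivity
    nlinarith
  have hR : r ^ (m + 8) ≤ (1 + r ^ 2) ^ (m + 4) :=
    calc r ^ (m + 8) ≤ r ^ (2 * (m + 4)) := pow_le_pow_right₀ hr (by omega)
      _ = (r ^ 2) ^ (m + 4) := pow_mul _ _ _
      _ ≤ _ := by gcongr; linarith
  rw [norm_mul, Real.norm_of_nonneg (by positivity), Real.norm_eq_abs, ← div_eq_mul_inv,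
    div_mul_eq_mul_div, div_le_div_iff₀ (by positivity) hr0]
  calc r ^ (m + 7) * |a + b * r ^ 2 + d * r ^ 4| * r
      = r ^ (m + 8) * |a + b * r ^ 2 + d * r ^ 4| := by ring
    _ ≤ (1 + r ^ 2) ^ (m + 4) * ((|a| + |b| + |d|) * (1 + r ^ 2) ^ 2) := by gcongr
    _ = _ := by ring

lemma integral_normSq_div_one_add_normSq_pow (m : ℕ) :
    ∫ x : En (m + 7), ‖x‖ ^ 2 / (1 + ‖x‖ ^ 2) ^ (m + 5) =
      4 * ((m : ℝ) + 7) * (m + 6) / ((m + 3) * (m + 1)) *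
        ∫ x : En (m + 7), 1 / (1 + ‖x‖ ^ 2) ^ (m + 7) := by
  have i1 := (integrable_fun_norm_addHaar (volume : Measure (En (m + 7)))
    (f := fun r : ℝ => r ^ 2 / (1 + r ^ 2) ^ (m + 5))).1
      (integrable_normSq_div_one_add_normSq_pow m)
  have i2 := (integrable_fun_norm_addHaar (volume : Measure (En (m + 7)))
    (f := fun r : ℝ => 1 / (1 + r ^ 2) ^ (m + 7))).1
      (integrable_one_div_one_add_normSq_pow m)
  rw [integral_fun_norm_addHaar (volume : Measure (En (m + 7)))
      (fun r : ℝ => r ^ 2 / (1 + r ^ 2) ^ (m + 5)),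
    integral_fun_norm_addHaar (volume : Measure (En (m + 7)))
      (fun r : ℝ => 1 / (1 + r ^ 2) ^ (m + 7))]
  simp only [finrank_euclideanSpace_fin, show m + 7 - 1 = m + 6 by omega, smul_eq_mul,
    nsmul_eq_mul] at i1 i2 ⊢
  have p1 : (0 : ℝ) < m + 1 := by positivity
  have p3 : (0 : ℝ) < m + 3 := by positivity
  have p5 : (0 : ℝ) < m + 5 := by positivity
  have key := integral_Ioi_of_hasDerivAt_of_tendsto' (a := 0)
    (fun r _ => hasDerivAt_radial_primitive m (d := -1 / (m + 1))
      (b := -(3 * m + 13) / ((m + 1) * (m + 3))) (a := -4 * (m + 6) / ((m + 1) * (m + 3)))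
      (by field_simp) (by field_simp; ring) (by field_simp; ring) r)
    (i1.add (i2.const_mul _)) (tendsto_radial_primitive m _ _ _)
  rw [integral_add i1 (i2.const_mul _), integral_const_mul] at key
  have e : ∫ r in Set.Ioi (0 : ℝ), r ^ (m + 6) * (r ^ 2 / (1 + r ^ 2) ^ (m + 5)) =
      4 * ((m : ℝ) + 7) * (m + 6) / ((m + 3) * (m + 1)) *
        ∫ r in Set.Ioi (0 : ℝ), r ^ (m + 6) * (1 / (1 + r ^ 2) ^ (m + 7)) := by
    rw [zero_pow (by omega), zero_div, zero_mul, sub_zero] at key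
    rw [eq_neg_of_add_eq_zero_left key]
    ring
  rw [e]
  ring

lemma integral_comp_linearIsometryEquiv {n : ℕ} (e : En n ≃ₗᵢ[ℝ] En n) (f : En n → ℝ) :
    ∫ x, f (e x) = ∫ x, f x :=
  e.measurePreserving.integral_comp e.toHomeomorph.measurableEmbedding f

lemma integral_coord_mul_coord_of_ne {n : ℕ} (φ : ℝ → ℝ) {p q : Fin n} (hpq : p ≠ q) :
    ∫ x : En n, x p * x q * φ ‖x‖ = 0 := by
  let e : En n ≃ₗᵢ[ℝ] En n := LinearIsometryEquiv.piLpCongrRight 2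
    (fun i => if i = p then LinearIsometryEquiv.neg ℝ else LinearIsometryEquiv.refl ℝ ℝ)
  have h := integral_comp_linearIsometryEquiv e (fun x => x p * x q * φ ‖x‖)
  have hp (x : En n) : e x p = -x p := by simp [e, LinearIsometryEquiv.piLpCongrRight_apply]
  have hq (x : En n) : e x q = x q := by
    simp [e, LinearIsometryEquiv.piLpCongrRight_apply, hpq.symm]
  simp only [hp, hq, LinearIsometryEquiv.norm_map, neg_mul, integral_neg] at h
  linarith

lemma integral_coord_sq_eq {n : ℕ} (φ : ℝ → ℝ) (p q : Fin n) :
    ∫ x : En n, x p * x p * φ ‖x‖ = ∫ x : En n, x q * x q * φ ‖x‖ := by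
  have h := integral_comp_linearIsometryEquiv
    (LinearIsometryEquiv.piLpCongrLeft 2 ℝ ℝ (Equiv.swap p q)) (fun x => x q * x q * φ ‖x‖)
  rw [← h]
  simp [LinearIsometryEquiv.piLpCongrLeft_apply, Equiv.piCongrLeft']

lemma integrable_coord_mul_coord {n : ℕ} {φ : ℝ → ℝ} (hm : Measurable φ)
    (hφ : Integrable (fun x : En n => ‖x‖ ^ 2 * φ ‖x‖)) (p q : Fin n) :
    Integrable (fun x : En n => x p * x q * φ ‖x‖) := by
  refine hφ.mono (Measurable.aestronglyMeasurable (by fun_prop)) (ae_of_all _ fun x => ?_)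
  rw [norm_mul, norm_mul, norm_mul, norm_pow, norm_norm, sq]
  gcongr <;> exact PiLp.norm_apply_le x _

lemma integral_coord_sq {n : ℕ} {φ : ℝ → ℝ} (hm : Measurable φ)
    (hφ : Integrable (fun x : En n => ‖x‖ ^ 2 * φ ‖x‖)) (p : Fin n) :
    ∫ x : En n, x p * x p * φ ‖x‖ = (∫ x : En n, ‖x‖ ^ 2 * φ ‖x‖) / n := by
  have hn : (n : ℝ) ≠ 0 := by
    have := p.pos
    positivity
  have h : ∀ x : En n, ‖x‖ ^ 2 * φ ‖x‖ = ∑ q, x q * x q * φ ‖x‖ := fun x => by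
    rw [EuclideanSpace.real_norm_sq_eq, Finset.sum_mul]
    simp only [sq]
  rw [eq_div_iff hn, integral_congr_ae (ae_of_all _ h),
    integral_finsetSum _ fun q _ => integrable_coord_mul_coord hm hφ q q,
    Finset.sum_congr rfl fun q _ => integral_coord_sq_eq φ q p]
  simp [mul_comm]

/-- The integral of a quadratic form against a radial weight only sees its trace. -/
lemma integral_quadratic_form_mul_radial {n : ℕ} {φ : ℝ → ℝ} (hm : Measurable φ)
    (hφ : Integrable (fun x : En n => ‖x‖ ^ 2 * φ ‖x‖)) (A : Fin n → Fin n → ℝ) :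
    ∫ x : En n, ∑ p, ∑ q, A p q * (x p * x q * φ ‖x‖) =
      (∑ p, A p p) * ((∫ x : En n, ‖x‖ ^ 2 * φ ‖x‖) / n) := by
  have hi (p q : Fin n) := (integrable_coord_mul_coord hm hφ p q).const_mul (A p q)
  rw [integral_finsetSum _ fun p _ => integrable_finsetSum _ fun q _ => hi p q, Finset.sum_mul]
  refine Finset.sum_congr rfl fun p _ => ?_
  rw [integral_finsetSum _ fun q _ => hi p q, Finset.sum_eq_single p, integral_const_mul,
    integral_coord_sq hm hφ]
  · intro q _ hq
    rw [integral_const_mul, integral_coord_mul_coord_of_ne φ hq.symm, mul_zero]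
  · simp

lemma pd_hW {n : ℕ} {W : Fin n → Fin n → Fin n → Fin n → ℝ} (hW' : IsWeyl n W)
    (i j l : Fin n) (x : En n) :
    pd i (fun y => hW n W y j l) x = 1 / 3 * ∑ p, (W p l i j + W p j i l) * x p := by
  obtain ⟨h1, h2, h3, -, -⟩ := hW'
  have hc (p : Fin n) : HasFDerivAt (fun y : En n => y p)
      (EuclideanSpace.proj p : En n →L[ℝ] ℝ) x :=
    (EuclideanSpace.proj p : En n →L[ℝ] ℝ).hasFDerivAt
  have hd : HasFDerivAt (fun y => hW n W y j l) ((1 / 3 : ℝ) • ∑ p, ∑ q,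
      ((W j p l q * x p) • (EuclideanSpace.proj q : En n →L[ℝ] ℝ) +
        x q • (W j p l q • (EuclideanSpace.proj p : En n →L[ℝ] ℝ)))) x := by
    unfold hW
    exact (HasFDerivAt.fun_sum fun p _ => HasFDerivAt.fun_sum fun q _ =>
      ((hc p).const_mul _).mul (hc q)).const_mul _
  rw [pd, hd.fderiv]
  simp only [smul_apply, sum_apply,
    add_apply, PiLp.proj_apply, smul_eq_mul, PiLp.single_apply,
    Finset.sum_add_distrib]
  rw [Finset.sum_comm (f := fun p q => x q * _)]
  simp only [mul_ite, mul_one, mul_zero, Finset.sum_ite_eq', Finset.mem_univ, if_true]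
  rw [← Finset.sum_add_distrib]
  congr 1
  refine Finset.sum_congr rfl fun p _ => ?_
  rw [h1 p j, h2 j p i l, h3 p l i j, h1 i j, h2 j i p l]
  ring

/-- The sum of the squared derivatives of `hW` is the quadratic form of `Tkl`. -/
lemma sum_pd_hW_sq {n : ℕ} {W : Fin n → Fin n → Fin n → Fin n → ℝ} (hW' : IsWeyl n W) (x : En n) :
    ∑ i, ∑ j, ∑ l, (pd i (fun y => hW n W y j l) x) ^ 2 =
      1 / 9 * ∑ k, ∑ k', Tkl n W k k' * (x k * x k') := by
  have rot (g : Fin n → Fin n → Fin n → ℝ) :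
      ∑ p, ∑ q, ∑ r, g p q r = ∑ q, ∑ r, ∑ p, g p q r := by
    rw [Finset.sum_comm]
    exact Finset.sum_congr rfl fun _ _ => Finset.sum_comm
  let f : Fin n → Fin n → Fin n → Fin n → Fin n → ℝ := fun k k' p q r =>
    (W k p q r + W k r q p) * (W k' p q r + W k' r q p) * (x k * x k')
  have hf (i j l : Fin n) :
      (pd i (fun y => hW n W y j l) x) ^ 2 = 1 / 9 * ∑ k, ∑ k', f k k' l i j := by
    rw [pd_hW hW', mul_pow, sq (∑ p, _), Finset.sum_mul_sum]
    norm_num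
    refine Finset.sum_congr rfl fun k _ => Finset.sum_congr rfl fun k' _ => ?_
    simp only [f]
    ring
  have hT (k k' : Fin n) : Tkl n W k k' * (x k * x k') = ∑ p, ∑ q, ∑ r, f k k' p q r := by
    simp only [Tkl, Finset.sum_mul, f]
  simp only [hf, hT, ← Finset.mul_sum]
  congr 1
  calc ∑ i, ∑ j, ∑ l, ∑ k, ∑ k', f k k' l i j
      = ∑ i, ∑ j, ∑ k, ∑ k', ∑ l, f k k' l i j :=
        Finset.sum_congr rfl fun i _ => Finset.sum_congr rfl fun j _ => rot _
    _ = ∑ i, ∑ k, ∑ k', ∑ j, ∑ l, f k k' l i j := Finset.sum_congr rfl fun i _ => rot _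
    _ = ∑ k, ∑ k', ∑ i, ∑ j, ∑ l, f k k' l i j := rot _
    _ = ∑ k, ∑ k', ∑ l, ∑ i, ∑ j, f k k' l i j :=
        Finset.sum_congr rfl fun k _ => Finset.sum_congr rfl fun k' _ => (rot _).symm

theorem stmt12 (n : ℕ) (hn : 7 ≤ n) (W : Fin n → Fin n → Fin n → Fin n → ℝ)
    (hWeyl : IsWeyl n W) (t : ℝ) (ht : 0 < t) :
    (∫ x : En n,
        (∑ i, ∑ j, ∑ l, (pd i (fun y => hW n W y j l) x) ^ 2) * (Bub n t 0 x) ^ 2) =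
      4 * (n : ℝ) * ((n : ℝ) - 1) * ((n : ℝ) - 2) /
          (9 * ((n : ℝ) - 4) * ((n : ℝ) - 6)) *
        (∑ k, Tkl n W k k) * t ^ 4 *
        ∫ x : En n, (1 + ‖x‖ ^ 2 / ((n : ℝ) * ((n : ℝ) - 2))) ^ (-(n : ℝ)) := by
  obtain ⟨m, rfl⟩ := Nat.exists_eq_add_of_le' hn
  set c : ℝ := ((m + 7 : ℕ) : ℝ) * (((m + 7 : ℕ) : ℝ) - 2) with hc
  have hcv : c = (m + 7) * (m + 5) := by rw [hc]; push_cast; ring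
  have hc0 : 0 < c := by rw [hcv]; positivity
  have hs0 : 0 < √c := Real.sqrt_pos.2 hc0
  have hsc : √c ^ 2 = c := Real.sq_sqrt hc0.le
  let φ : ℝ → ℝ := fun r => t ^ (m + 5) / (t ^ 2 + r ^ 2 / c) ^ (m + 5)
  have hφm : Measurable φ := by fun_prop
  have hB (x : En (m + 7)) : Bub (m + 7) t 0 x ^ 2 = φ ‖x‖ := by
    have hb : 0 < t ^ 2 + ‖x‖ ^ 2 / c := by positivity
    rw [Bub, sub_zero, ← hc, mul_pow, ← Real.rpow_mul_natCast ht.le,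
      ← Real.rpow_mul_natCast hb.le,
      show (((m + 7 : ℕ) : ℝ) - 2) / 2 * (2 : ℕ) = ((m + 5 : ℕ) : ℝ) by push_cast; ring,
      show -((((m + 7 : ℕ) : ℝ) - 2) / 2) * (2 : ℕ) = -((m + 5 : ℕ) : ℝ) by push_cast; ring,
      Real.rpow_neg hb.le, Real.rpow_natCast, Real.rpow_natCast, ← div_eq_mul_inv]
  have hscale (x : En (m + 7)) : ‖x‖ ^ 2 * φ ‖x‖ = c * t ^ 2 * t ^ (m + 5) / (t ^ 2) ^ (m + 5) *
      (fun u : En (m + 7) => ‖u‖ ^ 2 / (1 + ‖u‖ ^ 2) ^ (m + 5)) ((t * √c)⁻¹ • x) := by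
    have hu : ‖(t * √c)⁻¹ • x‖ ^ 2 = ‖x‖ ^ 2 / (t ^ 2 * c) := by
      rw [norm_smul, Real.norm_of_nonneg (by positivity), mul_pow, inv_pow, mul_pow, hsc]
      ring
    have hb : t ^ 2 + ‖x‖ ^ 2 / c = t ^ 2 * (1 + ‖x‖ ^ 2 / (t ^ 2 * c)) := by field_simp
    simp only [φ, hu]
    rw [hb, mul_pow]
    field_simp
  have hφi : Integrable (fun x : En (m + 7) => ‖x‖ ^ 2 * φ ‖x‖) := by
    simp only [hscale]
    exact ((integrable_normSq_div_one_add_normSq_pow m).comp_smul (by positivity)).const_mul _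
  have hscale' (x : En (m + 7)) : (1 + ‖x‖ ^ 2 / c) ^ (-((m + 7 : ℕ) : ℝ)) =
      (fun u : En (m + 7) => 1 / (1 + ‖u‖ ^ 2) ^ (m + 7)) ((√c)⁻¹ • x) := by
    have hu : ‖(√c)⁻¹ • x‖ ^ 2 = ‖x‖ ^ 2 / c := by
      rw [norm_smul, Real.norm_of_nonneg (by positivity), mul_pow, inv_pow, hsc]
      ring
    simp only [hu]
    rw [Real.rpow_neg (by positivity), Real.rpow_natCast, one_div]
  have hq (x : En (m + 7)) :
      (∑ i, ∑ j, ∑ l, (pd i (fun y => hW (m + 7) W y j l) x) ^ 2) * Bub (m + 7) t 0 x ^ 2 =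
        ∑ k, ∑ k', 1 / 9 * Tkl (m + 7) W k k' * (x k * x k' * φ ‖x‖) := by
    rw [hB, sum_pd_hW_sq hWeyl]
    simp only [Finset.mul_sum, Finset.sum_mul, mul_assoc]
  simp only [hq]
  rw [integral_quadratic_form_mul_radial hφm hφi]
  rw [integral_congr_ae (ae_of_all _ hscale), integral_congr_ae (ae_of_all _ hscale'),
    integral_const_mul,
    Measure.integral_comp_inv_smul volume
      (fun u : En (m + 7) => ‖u‖ ^ 2 / (1 + ‖u‖ ^ 2) ^ (m + 5)) (t * √c),
    Measure.integral_comp_inv_smul volume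
      (fun u : En (m + 7) => 1 / (1 + ‖u‖ ^ 2) ^ (m + 7)) (√c),
    integral_normSq_div_one_add_normSq_pow, finrank_euclideanSpace_fin,
    abs_of_pos (by positivity), abs_of_pos (by positivity), ← Finset.mul_sum]
  generalize (∫ x : En (m + 7), 1 / (1 + ‖x‖ ^ 2) ^ (m + 7)) = I
  have e1 : ((m + 7 : ℕ) : ℝ) - 1 = m + 6 := by push_cast; ring
  have e2 : ((m + 7 : ℕ) : ℝ) - 2 = m + 5 := by push_cast; ring
  have e4 : ((m + 7 : ℕ) : ℝ) - 4 = m + 3 := by push_cast; ring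
  have e6 : ((m + 7 : ℕ) : ℝ) - 6 = m + 1 := by push_cast; ring
  have e7 : ((m + 7 : ℕ) : ℝ) = m + 7 := by push_cast; ring
  rw [e1, e2, e4, e6, e7, hcv, smul_eq_mul, smul_eq_mul, mul_pow t]
  generalize √((m + 7) * (m + 5) : ℝ) ^ (m + 7) = S
  field_simp
  ring
end
end

section
/- Let n ≥ 11, let W be a four-linear form on ℝⁿ with the symmetries of a Weyl tensor, and let h_{ij}(x) = (1/3)∑_{p,q=1}^n W_{ipjq} x_p x_q. Then for every t > 0 and all k, l ∈ {1,…,n}: (1/(2n²)) ∫_{ℝⁿ} ∑_{p=1}^n h_{kp}(x) h_{pl}(x) · t^{n−2} (t² + |x|²/(n(n−2)))^{−n} dx = (t²/36) · ((n−2)/(n−4)) · T_{kl} · ∫_{ℝⁿ} (1 + |x|²/(n(n−2)))^{−n} dx. -/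
open MeasureTheory Real

noncomputable section

/-- The radial weight `(a + c‖x‖²)^(-s)` on `ℝⁿ`. -/
def radialWeight (n : ℕ) (a c s : ℝ) (x : En n) : ℝ := (a + c * ‖x‖ ^ 2) ^ (-s)

section RadialMoments

variable {n : ℕ} {a c s : ℝ}

lemma continuous_radialWeight (ha : 0 < a) (hc : 0 < c) :
    Continuous (radialWeight n a c s) := by
  unfold radialWeight
  refine Continuous.rpow_const (by fun_prop) fun x => Or.inl ?_
  positivity

lemma integrable_mul_radialWeight (ha : 0 < a) (hc : 0 < c) (k : ℕ)
    (hs : (n : ℝ) + k < 2 * s) {f : En n → ℝ} (hf : Continuous f) (hfk : ∀ x, |f x| ≤ ‖x‖ ^ k) :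
    Integrable fun x => f x * radialWeight n a c s x := by
  have hint : Integrable (fun x : En n => ((1 : ℝ) + ‖x‖ ^ 2) ^ (-(2 * s - k) / 2)) :=
    integrable_rpow_neg_one_add_norm_sq (by simp only [finrank_euclideanSpace_fin]; linarith)
  refine (hint.const_mul ((min a c) ^ (-s))).mono'
    (hf.mul (continuous_radialWeight ha hc)).aestronglyMeasurable (.of_forall fun x => ?_)
  have hs0 : 0 ≤ s := by
    have := n.cast_nonneg (α := ℝ)
    have := k.cast_nonneg (α := ℝ)
    linarith
  have hb : 0 < min a c := lt_min ha hc
  have hN : 0 < 1 + ‖x‖ ^ 2 := by positivity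
  have hw : radialWeight n a c s x ≤ (min a c) ^ (-s) * (1 + ‖x‖ ^ 2) ^ (-s) := by
    rw [← Real.mul_rpow hb.le hN.le]
    refine Real.rpow_le_rpow_of_nonpos (by positivity) ?_ (by linarith)
    nlinarith [min_le_left a c, mul_le_mul_of_nonneg_right (min_le_right a c) (sq_nonneg ‖x‖)]
  have hk : ‖x‖ ^ k ≤ (1 + ‖x‖ ^ 2) ^ ((k : ℝ) / 2) := by
    rw [Real.rpow_div_two_eq_sqrt _ hN.le, Real.rpow_natCast]
    gcongr
    exact Real.le_sqrt_of_sq_le (by linarith)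
  have hw0 : 0 ≤ radialWeight n a c s x := by unfold radialWeight; positivity
  rw [Real.norm_eq_abs, abs_mul, abs_of_nonneg hw0]
  calc |f x| * radialWeight n a c s x
      ≤ (1 + ‖x‖ ^ 2) ^ ((k : ℝ) / 2) * ((min a c) ^ (-s) * (1 + ‖x‖ ^ 2) ^ (-s)) :=
        mul_le_mul ((hfk x).trans hk) hw hw0 (by positivity)
    _ = (min a c) ^ (-s) * (1 + ‖x‖ ^ 2) ^ (-(2 * s - k) / 2) := by
        rw [show -(2 * s - (k : ℝ)) / 2 = (k : ℝ) / 2 + -s by ring, Real.rpow_add hN]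
        ring

lemma abs_coord_le_norm (x : En n) (i : Fin n) : |x i| ≤ ‖x‖ := PiLp.norm_apply_le x i

lemma integrable_radialWeight (ha : 0 < a) (hc : 0 < c) (hs : (n : ℝ) < 2 * s) :
    Integrable (radialWeight n a c s) := by
  simpa using integrable_mul_radialWeight ha hc 0 (by simpa using hs)
    (f := fun _ => 1) continuous_const (by simp)

lemma integrable_coord_mul_radialWeight (ha : 0 < a) (hc : 0 < c) (hs : (n : ℝ) + 1 < 2 * s)
    (i : Fin n) : Integrable fun x : En n => x i * radialWeight n a c s x := by
  exact integrable_mul_radialWeight ha hc 1 (by simpa using hs) (by fun_prop)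
    (by simpa using fun x => abs_coord_le_norm x i)

lemma integrable_coord_mul₂_radialWeight (ha : 0 < a) (hc : 0 < c) (hs : (n : ℝ) + 2 < 2 * s)
    (i j : Fin n) : Integrable fun x : En n => x i * x j * radialWeight n a c s x := by
  refine integrable_mul_radialWeight ha hc 2 (by simpa using hs) (by fun_prop) fun x => ?_
  rw [abs_mul, pow_two]
  gcongr <;> exact abs_coord_le_norm x _

lemma integrable_coord_mul₃_radialWeight (ha : 0 < a) (hc : 0 < c) (hs : (n : ℝ) + 3 < 2 * s)
    (i j k : Fin n) : Integrable fun x : En n => x i * x j * x k * radialWeight n a c s x := by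
  refine integrable_mul_radialWeight ha hc 3 (by simpa using hs) (by fun_prop) fun x => ?_
  rw [abs_mul, abs_mul, pow_succ, pow_two]
  gcongr <;> exact abs_coord_le_norm x _

lemma integrable_coord_mul₄_radialWeight (ha : 0 < a) (hc : 0 < c) (hs : (n : ℝ) + 4 < 2 * s)
    (i j k l : Fin n) :
    Integrable fun x : En n => x i * x j * x k * x l * radialWeight n a c s x := by
  refine integrable_mul_radialWeight ha hc 4 (by simpa using hs) (by fun_prop) fun x => ?_
  rw [abs_mul, abs_mul, abs_mul, pow_succ, pow_succ, pow_two]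
  gcongr <;> exact abs_coord_le_norm x _

lemma hasLineDerivAt_coord (x : En n) (i j : Fin n) :
    HasLineDerivAt ℝ (fun y : En n => y j) (if i = j then 1 else 0) x
      (EuclideanSpace.single i 1) := by
  have h := ((EuclideanSpace.proj (𝕜 := ℝ) j).hasFDerivAt (x := x)).hasLineDerivAt
    (EuclideanSpace.single i (1 : ℝ))
  simpa [PiLp.single_apply, eq_comm] using h

lemma HasLineDerivAt.fun_mul {E : Type*} [AddCommGroup E] [Module ℝ E] {f g : E → ℝ} {f' g' : ℝ}
    {x v : E} (hf : HasLineDerivAt ℝ f f' x v) (hg : HasLineDerivAt ℝ g g' x v) :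
    HasLineDerivAt ℝ (fun y => f y * g y) (f' * g x + f x * g') x v := by
  simpa [HasLineDerivAt] using HasDerivAt.fun_mul hf hg

lemma hasLineDerivAt_radialWeight (ha : 0 < a) (hc : 0 < c) (x : En n) (i : Fin n) :
    HasLineDerivAt ℝ (radialWeight n a c (s - 1))
      (-(2 * c * (s - 1)) * (x i * radialWeight n a c s x)) x (EuclideanSpace.single i 1) := by
  have hpos : 0 < a + c * ‖x‖ ^ 2 := by positivity
  have h := ((((hasStrictFDerivAt_norm_sq x).hasFDerivAt.const_mul c).const_add a).rpow_const
    (p := -(s - 1)) (Or.inl hpos.ne')).hasLineDerivAt (EuclideanSpace.single i 1)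
  rw [show -(s - 1) - 1 = -s by ring] at h
  have hval : ((-(s - 1) * (a + c * ‖x‖ ^ 2) ^ (-s)) • c • 2 • innerSL ℝ x)
      (EuclideanSpace.single i 1) = -(2 * c * (s - 1)) * (x i * radialWeight n a c s x) := by
    have hinner : inner ℝ x (EuclideanSpace.single i 1) = x i := by
      simp [EuclideanSpace.inner_single_right]
    simp [radialWeight, hinner]
    ring
  rw [hval] at h
  exact h

lemma integral_coord_mul_radialWeight_eq (ha : 0 < a) (hc : 0 < c) (hs : 1 < s) (i : Fin n)
    {g g' : En n → ℝ} (hg : ∀ x, HasLineDerivAt ℝ g (g' x) x (EuclideanSpace.single i 1))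
    (hgx : Integrable fun x => g x * (x i * radialWeight n a c s x))
    (hg' : Integrable fun x => g' x * radialWeight n a c (s - 1) x)
    (hgw : Integrable fun x => g x * radialWeight n a c (s - 1) x) :
    ∫ x, g x * (x i * radialWeight n a c s x) =
      1 / (2 * c * (s - 1)) * ∫ x, g' x * radialWeight n a c (s - 1) x := by
  have h := integral_bilinear_hasLineDerivAt_right_eq_neg_left_of_integrable
    (μ := (volume : Measure (En n))) (B := ContinuousLinearMap.mul ℝ ℝ)
    (f := g) (f' := g') (g := radialWeight n a c (s - 1))
    (g' := fun x => -(2 * c * (s - 1)) * (x i * radialWeight n a c s x)) hg'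
    (by simpa [mul_left_comm] using hgx.const_mul (-(2 * c * (s - 1)))) hgw
    (fun x _ => hg x) (fun x _ => hasLineDerivAt_radialWeight ha hc x i)
  simp only [ContinuousLinearMap.mul_apply', mul_left_comm (g _) (-(2 * c * (s - 1))),
    integral_const_mul] at h
  have hs' : 0 < s - 1 := by linarith
  rw [one_div, eq_inv_mul_iff_mul_eq₀ (by positivity)]
  linarith

lemma integral_coord_mul₂_radialWeight (ha : 0 < a) (hc : 0 < c) (hs : 1 < s)
    (hns : (n : ℝ) + 3 < 2 * s) (i j : Fin n) :
    ∫ x : En n, x i * x j * radialWeight n a c s x =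
      1 / (2 * c * (s - 1)) * ((if i = j then 1 else 0) * ∫ x, radialWeight n a c (s - 1) x) := by
  rw [← integral_const_mul, ← integral_coord_mul_radialWeight_eq ha hc hs i
    (fun x => hasLineDerivAt_coord x i j)]
  · congr 1 with x
    ring
  · simpa [mul_assoc, mul_left_comm, mul_comm] using
      integrable_coord_mul₂_radialWeight ha hc (by linarith) i j
  · exact (integrable_radialWeight ha hc (by linarith)).const_mul _
  · exact integrable_coord_mul_radialWeight ha hc (by linarith) j

lemma integral_coord_mul₄_radialWeight (ha : 0 < a) (hc : 0 < c) (hs : 2 < s)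
    (hns : (n : ℝ) + 5 < 2 * s) (i j k l : Fin n) :
    ∫ x : En n, x i * x j * x k * x l * radialWeight n a c s x =
      1 / (4 * c ^ 2 * (s - 1) * (s - 2)) *
        ((if i = j then 1 else 0) * (if k = l then 1 else 0) +
          (if i = k then 1 else 0) * (if j = l then 1 else 0) +
          (if i = l then 1 else 0) * (if j = k then 1 else 0)) *
        ∫ x, radialWeight n a c (s - 2) x := by
  have hI (p q : Fin n) := integrable_coord_mul₂_radialWeight (a := a) (c := c) (s := s - 1)
    ha hc (by linarith) p q
  have hadd : Integrable fun x : En n =>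
      (if i = j then 1 else 0) * (x k * x l * radialWeight n a c (s - 1) x) +
        (if i = k then 1 else 0) * (x j * x l * radialWeight n a c (s - 1) x) :=
    ((hI k l).const_mul _).add ((hI j l).const_mul _)
  have hsplit (x : En n) :
      (((if i = j then (1 : ℝ) else 0) * x k + x j * (if i = k then 1 else 0)) * x l +
        x j * x k * (if i = l then 1 else 0)) * radialWeight n a c (s - 1) x =
      (if i = j then 1 else 0) * (x k * x l * radialWeight n a c (s - 1) x) +
        (if i = k then 1 else 0) * (x j * x l * radialWeight n a c (s - 1) x) +
        (if i = l then 1 else 0) * (x j * x k * radialWeight n a c (s - 1) x) := by ring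
  have h := integral_coord_mul_radialWeight_eq ha hc (by linarith : 1 < s) i
    (fun x => ((hasLineDerivAt_coord x i j).fun_mul (hasLineDerivAt_coord x i k)).fun_mul
      (hasLineDerivAt_coord x i l))
    ((integrable_coord_mul₄_radialWeight ha hc (by linarith) j k l i).congr
      (.of_forall fun x => by ring))
    (by
      simp only [hsplit]
      exact hadd.add ((hI j k).const_mul _))
    (integrable_coord_mul₃_radialWeight ha hc (by linarith) j k l)
  simp only [hsplit] at h
  rw [integral_add hadd ((hI j k).const_mul _),
    integral_add ((hI k l).const_mul _) ((hI j l).const_mul _)] at h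
  simp only [integral_const_mul, integral_coord_mul₂_radialWeight (n := n) ha hc
    (by linarith : 1 < s - 1) (by linarith)] at h
  rw [show s - 1 - 1 = s - 2 by ring] at h
  have h1 : s - 1 ≠ 0 := by linarith
  have h2 : s - 2 ≠ 0 := by linarith
  calc ∫ x : En n, x i * x j * x k * x l * radialWeight n a c s x
      = ∫ x : En n, x j * x k * x l * (x i * radialWeight n a c s x) := by
        congr 1 with x
        ring
    _ = _ := by
        rw [h]
        field_simp
        ring

lemma integral_radialWeight_sub_one (ha : 0 < a) (hc : 0 < c) (hs : 1 < s)
    (hns : (n : ℝ) + 3 < 2 * s) :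
    ∫ x, radialWeight n a c (s - 1) x =
      2 * a * (s - 1) / (2 * (s - 1) - n) * ∫ x, radialWeight n a c s x := by
  have hsplit (x : En n) : radialWeight n a c (s - 1) x =
      a * radialWeight n a c s x + ∑ i, c * (x i * x i * radialWeight n a c s x) := by
    have hpos : 0 < a + c * ‖x‖ ^ 2 := by positivity
    rw [← Finset.mul_sum, ← Finset.sum_mul]
    simp only [← pow_two, ← EuclideanSpace.real_norm_sq_eq]
    rw [radialWeight, show -(s - 1) = 1 + -s by ring, Real.rpow_add hpos, Real.rpow_one]
    simp only [radialWeight]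
    ring
  have hI (i : Fin n) := (integrable_coord_mul₂_radialWeight ha hc (by linarith) i i).const_mul c
  have h : ∫ x, radialWeight n a c (s - 1) x = a * (∫ x, radialWeight n a c s x) +
      n * (1 / (2 * (s - 1)) * ∫ x, radialWeight n a c (s - 1) x) := by
    conv_lhs => simp only [hsplit]
    rw [integral_add ((integrable_radialWeight ha hc (by linarith)).const_mul a)
      (integrable_finsetSum _ fun i _ => hI i), integral_finsetSum _ fun i _ => hI i]
    simp only [integral_const_mul, integral_coord_mul₂_radialWeight ha hc hs hns]
    simp only [if_true, one_mul, Finset.sum_const, Finset.card_univ, Fintype.card_fin,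
      nsmul_eq_mul]
    field_simp
  have h1 : 0 < s - 1 := by linarith
  have h2 : 0 < 2 * (s - 1) - (n : ℝ) := by linarith
  field_simp at h
  rw [div_mul_eq_mul_div, eq_div_iff h2.ne']
  linarith

lemma integral_radialWeight_sq_scale {t : ℝ} (ht : 0 < t) (hc : 0 < c) :
    ∫ x, radialWeight n (t ^ 2) c s x =
      t ^ ((n : ℝ) - 2 * s) * ∫ x, radialWeight n 1 c s x := by
  have h := Measure.integral_comp_smul (volume : Measure (En n)) (radialWeight n (t ^ 2) c s) t
  have hw (x : En n) : radialWeight n (t ^ 2) c s (t • x) =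
      t ^ (-(2 * s)) * radialWeight n 1 c s x := by
    simp only [radialWeight, norm_smul, Real.norm_eq_abs, mul_pow, sq_abs]
    rw [show t ^ 2 + c * (t ^ 2 * ‖x‖ ^ 2) = t ^ 2 * (1 + c * ‖x‖ ^ 2) by ring,
      Real.mul_rpow (by positivity) (by positivity), ← Real.rpow_natCast, ← Real.rpow_mul ht.le]
    congr 2
    push_cast
    ring
  simp only [hw, integral_const_mul, finrank_euclideanSpace_fin, smul_eq_mul] at h
  rw [abs_of_pos (by positivity)] at h
  rw [sub_eq_add_neg, Real.rpow_add ht, Real.rpow_natCast, mul_assoc, h,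
    mul_inv_cancel_left₀ (by positivity)]

end RadialMoments

section Weyl

variable {n : ℕ} {W : Fin n → Fin n → Fin n → Fin n → ℝ}

lemma hW_mul_hW (x : En n) (k p l : Fin n) :
    hW n W x k p * hW n W x p l =
      ∑ a, ∑ b, ∑ c, ∑ d, 1 / 9 * (W k a p b * W p c l d) * (x a * x b * x c * x d) := by
  simp only [hW]
  rw [mul_mul_mul_comm, Finset.sum_mul_sum]
  simp_rw [Finset.sum_mul_sum, Finset.mul_sum]
  refine Finset.sum_congr rfl fun a _ => ?_
  rw [Finset.sum_comm]
  refine Finset.sum_congr rfl fun b _ => Finset.sum_congr rfl fun c _ =>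
    Finset.sum_congr rfl fun d _ => ?_
  ring

lemma sum_swap_first_third (f : Fin n → Fin n → Fin n → ℝ) :
    ∑ p, ∑ q, ∑ r, f p q r = ∑ p, ∑ q, ∑ r, f r q p := by
  rw [Finset.sum_comm]
  conv_rhs => rw [Finset.sum_comm]
  exact Finset.sum_congr rfl fun q _ => Finset.sum_comm

lemma Tkl_eq (k l : Fin n) :
    Tkl n W k l = 2 * ∑ p, ∑ q, ∑ r, W k p q r * (W l p q r + W l r q p) := by
  have h := sum_swap_first_third fun p q r => W k p q r * (W l p q r + W l r q p)
  rw [two_mul]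
  nth_rw 2 [h]
  simp only [Tkl, ← Finset.sum_add_distrib]
  refine Finset.sum_congr rfl fun p _ => Finset.sum_congr rfl fun q _ =>
    Finset.sum_congr rfl fun r _ => ?_
  ring

lemma IsWeyl.sum_mul_delta (h : IsWeyl n W) (k l : Fin n) :
    ∑ p, ∑ a, ∑ b, ∑ c, ∑ d, W k a p b * W p c l d *
      ((if a = b then 1 else 0) * (if c = d then 1 else 0) +
        (if a = c then 1 else 0) * (if b = d then 1 else 0) +
        (if a = d then 1 else 0) * (if b = c then 1 else 0)) = Tkl n W k l / 2 := by
  obtain ⟨h1, h2, h3, h4, -⟩ := h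
  have htrace (i j : Fin n) : ∑ a, W i a j a = 0 := by
    rw [← h4 i j]
    exact Finset.sum_congr rfl fun a _ => by rw [h1, h2, neg_neg]
  have hterm (p : Fin n) : ∑ a, ∑ b, ∑ c, ∑ d, W k a p b * W p c l d *
      ((if a = b then 1 else 0) * (if c = d then 1 else 0) +
        (if a = c then 1 else 0) * (if b = d then 1 else 0) +
        (if a = d then 1 else 0) * (if b = c then 1 else 0)) =
      (∑ a, W k a p a) * (∑ c, W p c l c) +
        ∑ a, ∑ b, W k a p b * (W l a p b + W l b p a) := by
    simp [mul_add, Finset.sum_add_distrib, Finset.sum_mul_sum, h3 l]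
    ring
  rw [Finset.sum_congr rfl fun p _ => hterm p, Tkl_eq, mul_div_cancel_left₀ _ two_ne_zero,
    Finset.sum_comm (s := Finset.univ)]
  simp [htrace]

lemma IsWeyl.integral_sum_hW_mul_radialWeight (h : IsWeyl n W) {a c s : ℝ} (ha : 0 < a)
    (hc : 0 < c) (hs : 2 < s) (hns : (n : ℝ) + 5 < 2 * s) (k l : Fin n) :
    ∫ x, (∑ p, hW n W x k p * hW n W x p l) * radialWeight n a c s x =
      Tkl n W k l / (72 * c ^ 2 * (s - 1) * (s - 2)) * ∫ x, radialWeight n a c (s - 2) x := by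
  have hI (C : ℝ) (i j k l : Fin n) := (integrable_coord_mul₄_radialWeight (a := a) (c := c)
    (s := s) ha hc (by linarith) i j k l).const_mul C
  simp only [hW_mul_hW, Finset.sum_mul, mul_assoc _ (_ * _ * _ * _) (radialWeight n a c s _)]
  rw [integral_finsetSum _ fun p _ => integrable_finsetSum _ fun i _ =>
    integrable_finsetSum _ fun j _ => integrable_finsetSum _ fun i' _ =>
    integrable_finsetSum _ fun j' _ => hI _ i j i' j']
  have hsum (p : Fin n) : ∫ x, (∑ i, ∑ j, ∑ i', ∑ j', 1 / 9 * (W k i p j * W p i' l j') *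
      (x i * x j * x i' * x j' * radialWeight n a c s x)) =
      1 / (36 * c ^ 2 * (s - 1) * (s - 2)) * (∫ x, radialWeight n a c (s - 2) x) *
        ∑ i, ∑ j, ∑ i', ∑ j', W k i p j * W p i' l j' *
          ((if i = j then 1 else 0) * (if i' = j' then 1 else 0) +
            (if i = i' then 1 else 0) * (if j = j' then 1 else 0) +
            (if i = j' then 1 else 0) * (if j = i' then 1 else 0)) := by
    rw [integral_finsetSum _ fun i _ => integrable_finsetSum _ fun j _ =>
      integrable_finsetSum _ fun i' _ => integrable_finsetSum _ fun j' _ => hI _ i j i' j',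
      Finset.mul_sum]
    refine Finset.sum_congr rfl fun i _ => ?_
    rw [integral_finsetSum _ fun j _ => integrable_finsetSum _ fun i' _ =>
      integrable_finsetSum _ fun j' _ => hI _ i j i' j', Finset.mul_sum]
    refine Finset.sum_congr rfl fun j _ => ?_
    rw [integral_finsetSum _ fun i' _ => integrable_finsetSum _ fun j' _ => hI _ i j i' j',
      Finset.mul_sum]
    refine Finset.sum_congr rfl fun i' _ => ?_
    rw [integral_finsetSum _ fun j' _ => hI _ i j i' j', Finset.mul_sum]
    refine Finset.sum_congr rfl fun j' _ => ?_
    rw [integral_const_mul, integral_coord_mul₄_radialWeight ha hc hs hns]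
    have h1 : s - 1 ≠ 0 := by linarith
    have h2 : s - 2 ≠ 0 := by linarith
    field_simp
    ring
  rw [Finset.sum_congr rfl fun p _ => hsum p, ← Finset.mul_sum, h.sum_mul_delta]
  have h1 : s - 1 ≠ 0 := by linarith
  have h2 : s - 2 ≠ 0 := by linarith
  field_simp
  ring

end Weyl

theorem stmt13 (n : ℕ) (hn : 11 ≤ n) (W : Fin n → Fin n → Fin n → Fin n → ℝ)
    (hWeyl : IsWeyl n W) (t : ℝ) (ht : 0 < t) (k l : Fin n) :
    (1 / (2 * (n : ℝ) ^ 2)) *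
        (∫ x : En n, (∑ p, hW n W x k p * hW n W x p l) *
          (t ^ ((n : ℝ) - 2) *
            (t ^ 2 + ‖x‖ ^ 2 / ((n : ℝ) * ((n : ℝ) - 2))) ^ (-(n : ℝ)))) =
      t ^ 2 / 36 * (((n : ℝ) - 2) / ((n : ℝ) - 4)) * Tkl n W k l *
        ∫ x : En n, (1 + ‖x‖ ^ 2 / ((n : ℝ) * ((n : ℝ) - 2))) ^ (-(n : ℝ)) := by
  have hn' : (11 : ℝ) ≤ n := by exact_mod_cast hn
  set c : ℝ := ((n : ℝ) * ((n : ℝ) - 2))⁻¹ with hc_def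
  have hn2 : 0 < (n : ℝ) - 2 := by linarith
  have hn4 : 0 < (n : ℝ) - 4 := by linarith
  have hc : 0 < c := by positivity
  have hweight (a : ℝ) (x : En n) :
      (a + ‖x‖ ^ 2 / ((n : ℝ) * ((n : ℝ) - 2))) ^ (-(n : ℝ)) = radialWeight n a c n x := by
    rw [radialWeight, div_eq_inv_mul]
  simp only [hweight, mul_left_comm _ (t ^ ((n : ℝ) - 2)), integral_const_mul]
  have hJ₁ := integral_radialWeight_sub_one (n := n) (a := t ^ 2) (s := n) (by positivity) hc
    (by linarith) (by linarith)
  have hJ₂ := integral_radialWeight_sub_one (n := n) (a := t ^ 2) (s := n - 1) (by positivity) hc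
    (by linarith) (by linarith)
  rw [show (n : ℝ) - 1 - 1 = n - 2 by ring, hJ₁,
    integral_radialWeight_sq_scale (s := n) ht hc] at hJ₂
  rw [hWeyl.integral_sum_hW_mul_radialWeight (by positivity) hc (by linarith) (by linarith), hJ₂]
  have hpow : t ^ ((n : ℝ) - 2 * n) = (t ^ ((n : ℝ) - 2))⁻¹ * (t ^ 2)⁻¹ := by
    rw [← Real.rpow_natCast, ← Real.rpow_neg ht.le, ← Real.rpow_neg ht.le, ← Real.rpow_add ht]
    congr 1
    push_cast
    ring
  have h1 : (n : ℝ) - 1 ≠ 0 := by linarith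
  have h3 : 2 * ((n : ℝ) - 2) - n ≠ 0 := by linarith
  have h5 : 2 * ((n : ℝ) - 1) - n ≠ 0 := by linarith
  have ht' : t ^ ((n : ℝ) - 2) ≠ 0 := by positivity
  rw [hpow, hc_def, show 2 * ((n : ℝ) - 2) - n = n - 4 by ring,
    show 2 * ((n : ℝ) - 1) - n = n - 2 by ring]
  field_simp
  ring
end
end
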